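/- arXiv:2505.17216 — 6 statements merged into one kernel-verified Lean document; each statement's English description precedes it below -/
import Mathlib

section
/- Let N ≥ 1 be an integer, let g, u_m, α₁, …, α_N be real numbers, let h be a nonzero real number, and let A_{ijk}, B_{ijk} (1 ≤ i,j,k ≤ N) be arbitrary real numbers. Then the matrix T is invertible and T⁻¹ · A_c · T = A_p, where A_c and A_p are the convective and primitive SWME system matrices defined in the context. -/
/-- Transformation matrix `T` between primitive and convective variables. -/
noncomputable def Tmat (N : ℕ) (h um : ℝ) (α : ℕ → ℝ) :
    Matrix (Fin (N + 2)) (Fin (N + 2)) ℝ := fun r c =>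
  if c.val = 0 then (if r.val = 0 then 1 else if r.val = 1 then um else α (r.val - 1))
  else if r = c then h else 0

/-- Convective SWME system matrix `A_c`. -/
noncomputable def AcSWME (N : ℕ) (g h um : ℝ) (α : ℕ → ℝ) (A B : ℕ → ℕ → ℕ → ℝ) :
    Matrix (Fin (N + 2)) (Fin (N + 2)) ℝ := fun r c =>
  if r.val = 0 then (if c.val = 1 then 1 else 0)
  else if r.val = 1 then
    (if c.val = 0 then g * h - um ^ 2 - ∑ j ∈ Finset.Icc 1 N, (α j) ^ 2 / (2 * (j : ℝ) + 1)
     else if c.val = 1 then 2 * um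
     else 2 / (2 * (c.val : ℝ) - 1) * α (c.val - 1))
  else
    if c.val = 0 then
      -2 * um * α (r.val - 1) -
        ∑ j ∈ Finset.Icc 1 N, ∑ k ∈ Finset.Icc 1 N, A (r.val - 1) j k * α j * α k
    else if c.val = 1 then 2 * α (r.val - 1)
    else
      (∑ j ∈ Finset.Icc 1 N,
        (B (r.val - 1) (c.val - 1) j + 2 * A (r.val - 1) j (c.val - 1)) * α j)
        + (if r = c then um else 0)

/-- Primitive SWME system matrix `A_p`. -/
noncomputable def ApSWME (N : ℕ) (g h um : ℝ) (α : ℕ → ℝ) (A B : ℕ → ℕ → ℕ → ℝ) :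
    Matrix (Fin (N + 2)) (Fin (N + 2)) ℝ := fun r c =>
  if r.val = 0 then (if c.val = 0 then um else if c.val = 1 then h else 0)
  else if r.val = 1 then
    (if c.val = 0 then g + (1 / h) * ∑ j ∈ Finset.Icc 1 N, (α j) ^ 2 / (2 * (j : ℝ) + 1)
     else if c.val = 1 then um
     else 2 / (2 * (c.val : ℝ) - 1) * α (c.val - 1))
  else
    if c.val = 0 then
      (1 / h) * ∑ j ∈ Finset.Icc 1 N, ∑ k ∈ Finset.Icc 1 N,
        (B (r.val - 1) j k + A (r.val - 1) j k) * α j * α k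
    else if c.val = 1 then α (r.val - 1)
    else
      (∑ j ∈ Finset.Icc 1 N,
        (B (r.val - 1) (c.val - 1) j + 2 * A (r.val - 1) j (c.val - 1)) * α j)
        + (if r = c then um else 0)

lemma sum_Icc_one_eq_sum_fin (N : ℕ) (f : ℕ → ℝ) :
    ∑ j ∈ Finset.Icc 1 N, f j = ∑ i : Fin N, f (i.val + 1) := by
  rw [Fin.sum_univ_eq_sum_range (fun i => f (i + 1)), Finset.range_eq_Ico,
    Finset.sum_Ico_add' f 0 N 1]
  rfl

lemma det_Tmat (N : ℕ) (h um : ℝ) (α : ℕ → ℝ) : (Tmat N h um α).det = h ^ (N + 1) := by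
  rw [Matrix.det_of_isLowerTriangular]
  · rw [Fin.prod_univ_succ]
    simp [Tmat]
  · intro i j hij
    have hij' : i < j := hij
    have hj : j ≠ 0 := Fin.ne_zero_of_lt hij'
    simp [Tmat, hj, hij'.ne]

lemma mul_Tmat_apply_zero (N : ℕ) (h um : ℝ) (α : ℕ → ℝ)
    (M : Matrix (Fin (N + 2)) (Fin (N + 2)) ℝ) (r : Fin (N + 2)) :
    (M * Tmat N h um α) r 0 =
      M r 0 + M r 1 * um + ∑ l : Fin N, M r l.succ.succ * α (l.val + 1) := by
  rw [Matrix.mul_apply, Fin.sum_univ_succ, Fin.sum_univ_succ]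
  simp [Tmat, add_assoc]

lemma mul_Tmat_apply_succ (N : ℕ) (h um : ℝ) (α : ℕ → ℝ)
    (M : Matrix (Fin (N + 2)) (Fin (N + 2)) ℝ) (r : Fin (N + 2)) (c : Fin (N + 1)) :
    (M * Tmat N h um α) r c.succ = M r c.succ * h := by
  simp [Matrix.mul_apply, Tmat]

lemma Tmat_mul_apply_zero (N : ℕ) (h um : ℝ) (α : ℕ → ℝ)
    (M : Matrix (Fin (N + 2)) (Fin (N + 2)) ℝ) (c : Fin (N + 2)) :
    (Tmat N h um α * M) 0 c = M 0 c := by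
  rw [Matrix.mul_apply, Fin.sum_univ_succ]
  simp [Tmat, (Fin.succ_ne_zero _).symm]

lemma Tmat_mul_apply_succ (N : ℕ) (h um : ℝ) (α : ℕ → ℝ)
    (M : Matrix (Fin (N + 2)) (Fin (N + 2)) ℝ) (r : Fin (N + 1)) (c : Fin (N + 2)) :
    (Tmat N h um α * M) r.succ c = Tmat N h um α r.succ 0 * M 0 c + h * M r.succ c := by
  rw [Matrix.mul_apply, Fin.sum_univ_succ]
  simp [Tmat]

lemma AcSWME_mul_Tmat (N : ℕ) (g um : ℝ) (h : ℝ) (hh : h ≠ 0) (α : ℕ → ℝ)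
    (A B : ℕ → ℕ → ℕ → ℝ) :
    AcSWME N g h um α A B * Tmat N h um α = Tmat N h um α * ApSWME N g h um α A B := by
  ext r c
  refine Fin.cases ?_ (fun r => ?_) r
  · rw [Tmat_mul_apply_zero]
    refine Fin.cases ?_ (fun c => ?_) c
    · rw [mul_Tmat_apply_zero]
      simp [AcSWME, ApSWME]
    · rw [mul_Tmat_apply_succ]
      simp [AcSWME, ApSWME]
  · rw [Tmat_mul_apply_succ]
    refine Fin.cases ?_ (fun c => ?_) c
    · rw [mul_Tmat_apply_zero]
      refine Fin.cases ?_ (fun i => ?_) r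
      · have key : ∑ l : Fin N, 2 / (2 * ((l : ℝ) + 1 + 1) - 1) * α (l + 1) * α (l + 1) =
            2 * ∑ l : Fin N, α (l + 1) ^ 2 / (2 * ((l : ℝ) + 1) + 1) := by
          rw [Finset.mul_sum]
          refine Finset.sum_congr rfl fun l _ => ?_
          rw [show 2 * ((l : ℝ) + 1 + 1) - 1 = 2 * ((l : ℝ) + 1) + 1 by ring]
          ring
        simp [AcSWME, ApSWME, Tmat, sum_Icc_one_eq_sum_fin, key]
        field_simp
        ring
      · have key : ∑ l : Fin N, ∑ j : Fin N, A (i + 1) (j + 1) (l + 1) * α (j + 1) * α (l + 1) =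
            ∑ j : Fin N, ∑ l : Fin N, A (i + 1) (j + 1) (l + 1) * α (j + 1) * α (l + 1) :=
          Finset.sum_comm
        have row : ∑ l : Fin N, ((∑ j : Fin N, (B (i + 1) (l + 1) (j + 1) +
              2 * A (i + 1) (j + 1) (l + 1)) * α (j + 1)) + if i = l then um else 0) *
                α (l + 1) =
            (∑ j : Fin N, ∑ k : Fin N, B (i + 1) (j + 1) (k + 1) * α (j + 1) * α (k + 1)) +
            2 * (∑ j : Fin N, ∑ k : Fin N, A (i + 1) (j + 1) (k + 1) * α (j + 1) * α (k + 1)) +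
            um * α (i + 1) := by
          rw [← key]
          simp only [add_mul, Finset.sum_add_distrib, Finset.sum_mul, Finset.mul_sum]
          congr 1
          · congr 1 <;>
              exact Finset.sum_congr rfl fun _ _ => Finset.sum_congr rfl fun _ _ => by ring
          · simp
        simp [AcSWME, ApSWME, Tmat, sum_Icc_one_eq_sum_fin, row]
        simp only [add_mul, Finset.sum_add_distrib]
        field_simp
        ring
    · rw [mul_Tmat_apply_succ]
      refine Fin.cases ?_ (fun i => ?_) r <;> refine Fin.cases ?_ (fun l => ?_) c <;>
        simp [AcSWME, ApSWME, Tmat] <;> ring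

/-- The transformation matrix `T` is invertible and conjugating the convective SWME system
matrix by `T` yields the primitive SWME system matrix. -/
theorem stmt_0 (N : ℕ) (hN : 1 ≤ N) (g um : ℝ) (h : ℝ) (hh : h ≠ 0) (α : ℕ → ℝ)
    (A B : ℕ → ℕ → ℕ → ℝ) :
    IsUnit (Tmat N h um α) ∧
      (Tmat N h um α)⁻¹ * AcSWME N g h um α A B * Tmat N h um α = ApSWME N g h um α A B := by
  have hdet : IsUnit (Tmat N h um α).det := by
    rw [det_Tmat]
    exact (pow_ne_zero _ hh).isUnit
  refine ⟨(Matrix.isUnit_iff_isUnit_det _).2 hdet, ?_⟩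
  rw [Matrix.mul_assoc, AcSWME_mul_Tmat N g um h hh α A B,
    Matrix.nonsing_inv_mul_cancel_left _ _ hdet]
end

section
/- Let N ≥ 1 be an integer and α₁ a nonzero real number. Then for every λ ∈ ℝ, det(A₂ − λ·I_N) = ((−α₁)^N · N! / (2N+1)!!) · P'_{N+1}(λ/α₁). -/
open Polynomial

/-- The Legendre polynomial of degree `n` (Rodrigues' formula), normalized so `P n 1 = 1`. -/
noncomputable def legendre (n : ℕ) : Polynomial ℝ :=
  ((2 ^ n * n.factorial : ℝ))⁻¹ • (derivative^[n] ((X ^ 2 - 1) ^ n))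

/-- The tridiagonal matrix `A₂` with superdiagonal `((i+2)/(2i+3))·α₁` and
subdiagonal `(i/(2i+1))·α₁` (1-based indexing). -/
noncomputable def A2mat (N : ℕ) (α1 : ℝ) : Matrix (Fin N) (Fin N) ℝ := fun i j =>
  if (j : ℕ) = (i : ℕ) + 1 then (((i : ℕ) : ℝ) + 3) / (2 * ((i : ℕ) : ℝ) + 5) * α1
  else if (i : ℕ) = (j : ℕ) + 1 then (((j : ℕ) : ℝ) + 1) / (2 * ((j : ℕ) : ℝ) + 3) * α1
  else 0

namespace Matrix

/-- The `n × n` tridiagonal matrix with diagonal `a`, superdiagonal `b` and subdiagonal `c`. -/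
def tridiagonal {R : Type*} [Zero R] (a b c : ℕ → R) (n : ℕ) : Matrix (Fin n) (Fin n) R :=
  fun i j =>
    if (i : ℕ) = j then a i
    else if (j : ℕ) = i + 1 then b i
    else if (i : ℕ) = j + 1 then c j
    else 0

/-- The three-term recurrence for the determinants of tridiagonal matrices. -/
theorem det_tridiagonal_add_two {R : Type*} [CommRing R] (a b c : ℕ → R) (n : ℕ) :
    (tridiagonal a b c (n + 2)).det =
      a (n + 1) * (tridiagonal a b c (n + 1)).det - b n * c n * (tridiagonal a b c n).det := by
  have minor_last : (tridiagonal a b c (n + 2)).submatrix (Fin.last (n + 1)).succAbove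
      (Fin.last (n + 1)).succAbove = tridiagonal a b c (n + 1) := by
    ext i j
    simp [tridiagonal]
  have minor_prev : ((tridiagonal a b c (n + 2)).submatrix (Fin.last (n + 1)).succAbove
      (Fin.last n).castSucc.succAbove).det = b n * (tridiagonal a b c n).det := by
    rw [det_succ_column _ (Fin.last n), Fin.sum_univ_castSucc, Finset.sum_eq_zero]
    · have minor_minor : (((tridiagonal a b c (n + 2)).submatrix (Fin.last (n + 1)).succAbove
          (Fin.last n).castSucc.succAbove).submatrix (Fin.last n).succAbove
          (Fin.last n).succAbove) = tridiagonal a b c n := by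
        ext i j
        simp [tridiagonal, Fin.succAbove, Fin.lt_def]
      rw [minor_minor]
      simp [tridiagonal, ← two_mul]
    · intro i _
      have := i.isLt
      simp [tridiagonal, show (i : ℕ) ≠ n + 1 by omega, show n ≠ (i : ℕ) by omega,
        show (i : ℕ) ≠ n + 1 + 1 by omega]
  rw [det_succ_row _ (Fin.last (n + 1)), Fin.sum_univ_castSucc, Fin.sum_univ_castSucc,
    Finset.sum_eq_zero, minor_last, minor_prev]
  · have sign : (-1 : R) ^ (n + 1 + n) = -1 := Odd.neg_one_pow ⟨n, by ring⟩
    simp [tridiagonal, sign, show n ≠ n + 1 + 1 by omega]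
    ring
  · intro i _
    have := i.isLt
    simp [tridiagonal, show n + 1 ≠ (i : ℕ) by omega, show (i : ℕ) ≠ n + 1 + 1 by omega,
      show n ≠ (i : ℕ) by omega]

end Matrix

theorem derivative_legendre (n : ℕ) : derivative (legendre n) =
    C ((2 ^ n * n.factorial : ℝ))⁻¹ * derivative^[n + 1] ((X ^ 2 - 1) ^ n) := by
  rw [legendre, derivative_smul, Function.iterate_succ_apply', smul_eq_C_mul]

theorem derivative_legendre_succ (n : ℕ) : derivative (legendre (n + 1)) =
    X * derivative (legendre n) + C (n + 1 : ℝ) * legendre n := by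
  have h : derivative ((X ^ 2 - 1 : ℝ[X]) ^ (n + 1)) =
      C (2 * (n + 1) : ℝ) * ((X ^ 2 - 1) ^ n * X) := by
    simp [derivative_pow, map_ofNat C]
    ring
  rw [derivative_legendre, derivative_legendre, Function.iterate_succ_apply, h,
    iterate_derivative_C_mul, iterate_derivative_mul_X, legendre, smul_eq_C_mul]
  have hc : ((2 ^ (n + 1) * (n + 1).factorial : ℝ))⁻¹ * (2 * (n + 1)) =
      (2 ^ n * n.factorial : ℝ)⁻¹ := by
    push_cast [Nat.factorial_succ]
    field_simp
    ring
  rw [← mul_assoc, ← C_mul, hc]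
  simp
  ring

theorem derivative_legendre_add_two (n : ℕ) : derivative (legendre (n + 2)) =
    C (2 * n + 3 : ℝ) * legendre (n + 1) + derivative (legendre n) := by
  have h : derivative (derivative ((X ^ 2 - 1 : ℝ[X]) ^ (n + 2))) =
      C (2 * (n + 2) * (2 * n + 3) : ℝ) * (X ^ 2 - 1) ^ (n + 1) +
        C (4 * (n + 1) * (n + 2) : ℝ) * (X ^ 2 - 1) ^ n := by
    simp [derivative_pow, map_ofNat C]
    ring
  rw [derivative_legendre, derivative_legendre, Function.iterate_succ_apply,
    Function.iterate_succ_apply, h, iterate_map_add,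
    iterate_derivative_C_mul, iterate_derivative_C_mul, legendre, smul_eq_C_mul]
  have hc : ((2 ^ (n + 2) * (n + 2).factorial : ℝ))⁻¹ * (2 * (n + 2) * (2 * n + 3)) =
      (2 * n + 3) * (2 ^ (n + 1) * (n + 1).factorial : ℝ)⁻¹ := by
    push_cast [Nat.factorial_succ]
    field_simp
    ring
  have hd : ((2 ^ (n + 2) * (n + 2).factorial : ℝ))⁻¹ * (4 * (n + 1) * (n + 2)) =
      (2 ^ n * n.factorial : ℝ)⁻¹ := by
    push_cast [Nat.factorial_succ]
    field_simp
    ring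
  rw [mul_add, ← mul_assoc, ← mul_assoc, ← mul_assoc, ← C_mul, ← C_mul, ← C_mul, hc, hd]

/-- The three-term recurrence for derivatives of Legendre polynomials. -/
theorem derivative_legendre_recurrence (n : ℕ) :
    C (n + 1 : ℝ) * derivative (legendre (n + 2)) =
      C (2 * n + 3 : ℝ) * X * derivative (legendre (n + 1)) -
        C (n + 2 : ℝ) * derivative (legendre n) := by
  have h₁ := derivative_legendre_succ (n + 1)
  have h₂ := derivative_legendre_add_two n
  simp only [map_add, map_mul, map_ofNat, map_one, map_natCast, Nat.cast_add, Nat.cast_one]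
    at h₁ h₂ ⊢
  linear_combination (2 * (n : ℝ[X]) + 3) * h₁ - ((n : ℝ[X]) + 2) * h₂

theorem A2mat_sub_smul_one (N : ℕ) (α lam : ℝ) :
    A2mat N α - lam • (1 : Matrix (Fin N) (Fin N) ℝ) =
      Matrix.tridiagonal (fun _ => -lam) (fun i => ((i : ℝ) + 3) / (2 * (i : ℝ) + 5) * α)
        (fun i => ((i : ℝ) + 1) / (2 * (i : ℝ) + 3) * α) N := by
  ext i j
  by_cases h : i = j
  · simp [A2mat, Matrix.tridiagonal, h]
  · simp [A2mat, Matrix.tridiagonal, h, Fin.val_inj]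

theorem det_A2mat_sub_smul_one (α : ℝ) (hα : α ≠ 0) (lam : ℝ) (N : ℕ) :
    (A2mat N α - lam • (1 : Matrix (Fin N) (Fin N) ℝ)).det =
      (-α) ^ N * (N.factorial : ℝ) / (Nat.doubleFactorial (2 * N + 1) : ℝ) *
        (derivative (legendre (N + 1))).eval (lam / α) := by
  induction N using Nat.twoStepInduction with
  | zero => simp [legendre, ← two_mul]
  | one =>
    rw [derivative_legendre_add_two]
    simp [A2mat, legendre, Nat.doubleFactorial]
    field_simp
    norm_num
  | more n ih₀ ih₁ =>
    have hrec := congrArg (eval (lam / α)) (derivative_legendre_recurrence (n + 1))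
    simp only [eval_mul, eval_sub, eval_C, eval_X] at hrec
    rw [A2mat_sub_smul_one] at ih₀ ih₁ ⊢
    rw [Matrix.det_tridiagonal_add_two, ih₀, ih₁]
    have hP : eval (lam / α) (derivative (legendre (n + 2 + 1))) =
        ((2 * n + 5) * (lam / α) * eval (lam / α) (derivative (legendre (n + 1 + 1))) -
          (n + 3) * eval (lam / α) (derivative (legendre (n + 1)))) / (n + 2) := by
      rw [eq_div_iff (by positivity)]
      push_cast at hrec
      linear_combination hrec
    have hdf : (Nat.doubleFactorial (2 * n + 1) : ℝ) ≠ 0 :=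
      Nat.cast_ne_zero.2 (Nat.doubleFactorial_pos _).ne'
    have hdf₁ : (Nat.doubleFactorial (2 * (n + 1) + 1) : ℝ) =
        (2 * n + 3) * Nat.doubleFactorial (2 * n + 1) := by
      rw [show 2 * (n + 1) + 1 = 2 * n + 1 + 2 by ring, Nat.doubleFactorial_add_two]
      push_cast
      ring
    have hdf₂ : (Nat.doubleFactorial (2 * (n + 2) + 1) : ℝ) =
        (2 * n + 5) * ((2 * n + 3) * Nat.doubleFactorial (2 * n + 1)) := by
      rw [← hdf₁, show 2 * (n + 2) + 1 = 2 * (n + 1) + 1 + 2 by ring,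
        Nat.doubleFactorial_add_two]
      push_cast
      ring
    rw [hP, hdf₁, hdf₂, Nat.factorial_succ (n + 1), Nat.factorial_succ n]
    push_cast
    field_simp
    ring

/-- The characteristic polynomial of `A₂` is a rescaled derivative of a Legendre polynomial. -/
theorem stmt_1 (N : ℕ) (hN : 1 ≤ N) (α1 : ℝ) (hα1 : α1 ≠ 0) (lam : ℝ) :
    (A2mat N α1 - lam • (1 : Matrix (Fin N) (Fin N) ℝ)).det =
      (-α1) ^ N * (N.factorial : ℝ) / (Nat.doubleFactorial (2 * N + 1) : ℝ) *
        (derivative (legendre (N + 1))).eval (lam / α1) := by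
  exact det_A2mat_sub_smul_one α1 hα1 lam N
end

section
/- Let N ≥ 2 be an integer and g, h, u_m, α₁, α₂, …, α_N real numbers with gh + α₁² < Σ_{i=2}^N α_i²/(2i+1). Then the complexification of the matrix A^{MHSWME} has an eigenvalue with nonzero imaginary part; in particular, A^{MHSWME} is not diagonalizable over ℝ. -/
/-- Entry `(i,j)` (0-based) of the tridiagonal matrix `A₂`. -/
noncomputable def A2entry (α1 : ℝ) (i j : ℕ) : ℝ :=
  if j = i + 1 then ((i : ℝ) + 3) / (2 * (i : ℝ) + 5) * α1
  else if i = j + 1 then ((j : ℝ) + 1) / (2 * (j : ℝ) + 3) * α1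
  else 0

/-- The MHSWME system matrix in convective variables. -/
noncomputable def AMHSWME (N : ℕ) (g h um : ℝ) (α : ℕ → ℝ) :
    Matrix (Fin (N + 2)) (Fin (N + 2)) ℝ := fun r c =>
  if r.val = 0 then (if c.val = 1 then 1 else 0)
  else if r.val = 1 then
    (if c.val = 0 then g * h - um ^ 2 - ∑ j ∈ Finset.Icc 1 N, (α j) ^ 2 / (2 * (j : ℝ) + 1)
     else if c.val = 1 then 2 * um
     else 2 / (2 * (c.val : ℝ) - 1) * α (c.val - 1))
  else if c.val = 0 then
    (if r.val = 2 then -2 * um * α 1 else if r.val = 3 then -(2 / 3) * (α 1) ^ 2 else 0)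
  else if c.val = 1 then (if r.val = 2 then 2 * α 1 else 0)
  else (if r = c then um else 0) + A2entry (α 1) (r.val - 2) (c.val - 2)

/-- An eigenvalue of a diagonalizable real matrix, viewed over `ℂ`, is real. -/
theorem im_eq_zero_of_mem_spectrum_of_eq_conj_isDiag {n : Type*} [Fintype n] [DecidableEq n]
    {A P D : Matrix n n ℝ} (hP : IsUnit P) (hD : D.IsDiag) (h : A = P * D * P⁻¹) {z : ℂ}
    (hz : z ∈ spectrum ℂ (A.map (algebraMap ℝ ℂ))) : z.im = 0 := by
  obtain ⟨u, rfl⟩ := hP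
  let φ := (algebraMap ℝ ℂ).mapMatrix (m := n)
  have hA : A.map (algebraMap ℝ ℂ) =
      (Units.map φ.toMonoidHom u : Matrix n n ℂ) * φ D *
        ((Units.map φ.toMonoidHom u)⁻¹ : (Matrix n n ℂ)ˣ) := by
    rw [← Matrix.coe_units_inv] at h
    change φ A = φ u * φ D * φ (u⁻¹ : (Matrix n n ℝ)ˣ)
    rw [h, map_mul, map_mul]
  have hφD : φ D = Matrix.diagonal fun i => (D i i : ℂ) := by
    rw [← hD.diagonal_diag]
    ext i j
    by_cases hij : i = j <;> simp [φ, hij]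
  rw [hA, spectrum.units_conjugate, hφD, spectrum_diagonal] at hz
  obtain ⟨i, rfl⟩ := hz
  exact Complex.ofReal_im _

open Matrix in
/-- `um + μ` is an eigenvalue of the MHSWME matrix over `ℂ` as soon as
`μ² = gh + α₁² - ∑_{i ≥ 2} α_i² / (2i + 1)`. -/
theorem add_mem_spectrum_AMHSWME {N : ℕ} (hN : 2 ≤ N) (g h um : ℝ) (α : ℕ → ℝ) {μ : ℂ}
    (hμ : μ ^ 2 = ((g * h + α 1 ^ 2 -
      ∑ i ∈ Finset.Icc 2 N, α i ^ 2 / (2 * (i : ℝ) + 1) : ℝ) : ℂ)) :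
    (um + μ : ℂ) ∈ spectrum ℂ ((AMHSWME N g h um α).map (algebraMap ℝ ℂ)) := by
  obtain ⟨n, rfl⟩ := Nat.exists_eq_add_of_le' hN
  let v : Fin (n + 2 + 2) → ℂ :=
    Fin.cons 1 (Fin.cons (um + μ) (Fin.cons (2 * α 1) 0))
  have hv : (AMHSWME (n + 2) g h um α).map (algebraMap ℝ ℂ) *ᵥ v = (um + μ : ℂ) • v := by
    have hsum : ∑ j ∈ Finset.Icc 1 (n + 2), α j ^ 2 / (2 * (j : ℝ) + 1) =
        α 1 ^ 2 / 3 + ∑ j ∈ Finset.Icc 2 (n + 2), α j ^ 2 / (2 * (j : ℝ) + 1) := by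
      rw [← Finset.add_sum_Ioc_eq_sum_Icc (by lia : 1 ≤ n + 2)]
      norm_num
      rfl
    ext r
    rw [Matrix.mulVec, dotProduct, Fin.sum_univ_succ, Fin.sum_univ_succ, Fin.sum_univ_succ]
    refine Fin.cases ?_ (fun r => Fin.cases ?_ (fun r => Fin.cases ?_
      (fun r => Fin.cases ?_ (fun r => ?_) r) r) r) r
    · simp [-Fin.succ_zero_eq_one, -Fin.succ_zero_eq_one', v, AMHSWME]
    · simp [-Fin.succ_zero_eq_one, -Fin.succ_zero_eq_one', v, AMHSWME, hsum]
      push_cast at hμ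
      linear_combination -hμ
    · simp [-Fin.succ_zero_eq_one, -Fin.succ_zero_eq_one', v, AMHSWME, A2entry]
      ring
    · simp [-Fin.succ_zero_eq_one, -Fin.succ_zero_eq_one', v, AMHSWME, A2entry]
      ring
    · simp [-Fin.succ_zero_eq_one, -Fin.succ_zero_eq_one', v, AMHSWME, A2entry]
  rw [← Matrix.spectrum_toLin']
  refine Module.End.HasEigenvalue.mem_spectrum
    (Module.End.hasEigenvalue_of_hasEigenvector (x := v) ?_)
  refine ⟨Module.End.mem_eigenspace_iff.2 (by rw [Matrix.toLin'_apply, hv]), fun h0 => ?_⟩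
  simpa [v] using congrFun h0 0
/-- If `gh + α₁² < Σ_{i=2}^N α_i²/(2i+1)`, the complexification of the MHSWME system matrix
has an eigenvalue with nonzero imaginary part; in particular the matrix is not
diagonalizable over ℝ. -/
theorem stmt_7 (N : ℕ) (hN : 2 ≤ N) (g h um : ℝ) (α : ℕ → ℝ)
    (hgh : g * h + (α 1) ^ 2 < ∑ i ∈ Finset.Icc 2 N, (α i) ^ 2 / (2 * (i : ℝ) + 1)) :
    (∃ z : ℂ, z ∈ spectrum ℂ ((AMHSWME N g h um α).map (algebraMap ℝ ℂ)) ∧ z.im ≠ 0) ∧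
      ¬ ∃ P D : Matrix (Fin (N + 2)) (Fin (N + 2)) ℝ,
          IsUnit P ∧ D.IsDiag ∧ AMHSWME N g h um α = P * D * P⁻¹ := by
  set s := ∑ i ∈ Finset.Icc 2 N, (α i) ^ 2 / (2 * (i : ℝ) + 1)
  have hpos : 0 < s - (g * h + α 1 ^ 2) := by linarith
  have hμ : (Complex.I * √(s - (g * h + α 1 ^ 2))) ^ 2 = ((g * h + α 1 ^ 2 - s : ℝ) : ℂ) := by
    rw [mul_pow, Complex.I_sq, ← Complex.ofReal_pow, Real.sq_sqrt hpos.le]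
    push_cast
    ring
  have hz := add_mem_spectrum_AMHSWME hN g h um α hμ
  have him : (um + Complex.I * √(s - (g * h + α 1 ^ 2)) : ℂ).im ≠ 0 := by
    simpa using (Real.sqrt_pos.2 hpos).ne'
  refine ⟨⟨_, hz, him⟩, ?_⟩
  rintro ⟨P, D, hP, hD, h⟩
  exact him (im_eq_zero_of_mem_spectrum_of_eq_conj_isDiag hP hD h hz)
end

section
/- For every integer i ≥ 1, the coefficients of the shallow water moment hierarchy satisfy B_{i11} + A_{i11} = −1/3 if i = 2, and B_{i11} + A_{i11} = 0 if i ≠ 2. -/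
open Polynomial

/-- The shifted Legendre polynomial `φ_j(ζ) = P_j(1 − 2ζ)` on `[0,1]` with `φ_j(0) = 1`. -/
noncomputable def phi (j : ℕ) : Polynomial ℝ := (legendre j).comp (1 - 2 * X)

/-- The coefficient `A_{ijk} = (2i+1)·∫₀¹ φ_i φ_j φ_k dζ`. -/
noncomputable def Acoef (i j k : ℕ) : ℝ :=
  (2 * (i : ℝ) + 1) * ∫ ζ in (0 : ℝ)..1, (phi i).eval ζ * (phi j).eval ζ * (phi k).eval ζ

/-- The coefficient `B_{ijk} = (2i+1)·∫₀¹ φ_i'(ζ)·(∫₀^ζ φ_j)·φ_k(ζ) dζ`. -/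
noncomputable def Bcoef (i j k : ℕ) : ℝ :=
  (2 * (i : ℝ) + 1) * ∫ ζ in (0 : ℝ)..1,
    ((phi i).derivative.eval ζ) * (∫ s in (0 : ℝ)..ζ, (phi j).eval s) * (phi k).eval ζ

theorem Polynomial.integral_eval_derivative (W : ℝ[X]) (a b : ℝ) :
    ∫ x in a..b, W.derivative.eval x = W.eval b - W.eval a :=
  intervalIntegral.integral_eq_sub_of_hasDerivAt (fun x _ => W.hasDerivAt x)
    (W.derivative.continuous.intervalIntegrable a b)

theorem phi_one : phi 1 = 1 - 2 * X := by
  have h : legendre 1 = X := by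
    refine Polynomial.funext fun x => ?_
    simp [legendre, derivative_pow]
  rw [phi, h, X_comp]

theorem legendre_two : legendre 2 = C (3 / 2) * X ^ 2 - C (1 / 2) := by
  refine Polynomial.funext fun x => ?_
  simp [legendre, Function.iterate_succ, Nat.factorial, derivative_pow]
  ring

theorem integral_eval_phi_one (ζ : ℝ) : ∫ s in (0 : ℝ)..ζ, (phi 1).eval s = ζ - ζ ^ 2 := by
  have h : phi 1 = derivative (X - X ^ 2 : ℝ[X]) := by
    rw [phi_one]
    simp [derivative_pow, map_ofNat]
  rw [h, integral_eval_derivative]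
  simp

/-- Integration by parts turns `B_{i11} + A_{i11}` into a moment of `φ_i` against `ζ - ζ²`. -/
theorem Bcoef_add_Acoef_one_one (i : ℕ) :
    Bcoef i 1 1 + Acoef i 1 1 =
      (2 * (i : ℝ) + 1) * ∫ ζ in (0 : ℝ)..1, 2 * (ζ - ζ ^ 2) * (phi i).eval ζ := by
  have hc (p : ℝ[X]) : Continuous fun x => p.eval x := p.continuous
  have h := integral_eval_derivative (phi i * ((X - X ^ 2) * (1 - 2 * X))) 0 1
  have h0 : ∫ ζ in (0 : ℝ)..1, (derivative (phi i * ((X - X ^ 2) * (1 - 2 * X)))).eval ζ = 0 := by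
    rw [h]
    simp
  simp only [Bcoef, Acoef, integral_eval_phi_one]
  rw [← mul_add, ← intervalIntegral.integral_add]
  · congr 1
    refine Eq.trans ?_ (zero_add _)
    nth_rewrite 2 [← h0]
    rw [← intervalIntegral.integral_add]
    · congr 1 with ζ
      simp [phi_one]
      ring
    all_goals exact Continuous.intervalIntegrable (by fun_prop) _ _
  all_goals exact Continuous.intervalIntegrable (by fun_prop) _ _

/-- The lower order derivatives of `(X² - 1)ⁿ` vanish at `±1`. -/
theorem eval_iterate_derivative_sq_sub_one_pow {m n : ℕ} (h : m < n) {x : ℝ} (hx : x ^ 2 = 1) :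
    (derivative^[m] ((X ^ 2 - 1 : ℝ[X]) ^ n)).eval x = 0 := by
  obtain ⟨q, hq⟩ := (dvd_pow_self (X ^ 2 - 1 : ℝ[X]) (Nat.sub_ne_zero_of_lt h)).trans
    (pow_sub_dvd_iterate_derivative_of_pow_dvd m (dvd_refl ((X ^ 2 - 1 : ℝ[X]) ^ n)))
  rw [hq]
  simp [hx]

theorem integral_mul_eval_phi_add_three (n : ℕ) :
    ∫ ζ in (0 : ℝ)..1, 2 * (ζ - ζ ^ 2) * (phi (n + 3)).eval ζ = 0 := by
  set D : ℕ → ℝ[X] := fun k => derivative^[n + k] ((X ^ 2 - 1 : ℝ[X]) ^ (n + 3)) with hD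
  have hs (k : ℕ) : derivative (D k) = D (k + 1) :=
    (Function.iterate_succ_apply' _ _ _).symm
  have hv (k : ℕ) (hk : k < 3) (x : ℝ) (hx : x ^ 2 = 1) : (D k).eval x = 0 :=
    eval_iterate_derivative_sq_sub_one_pow (by omega) hx
  set c : ℝ := ((2 ^ (n + 3) * (n + 3).factorial : ℝ))⁻¹ with hc
  have hphi : phi (n + 3) = (C c * D 3).comp (1 - 2 * X) := by
    rw [phi, legendre, smul_eq_C_mul]
  have h := integral_eval_derivative
    ((C (-c / 4) * (D 2 * (1 - X ^ 2) + 2 * X * D 1 - 2 * D 0)).comp (1 - 2 * X)) 0 1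
  have e1 : (1 - 2 * 1 : ℝ) ^ 2 = 1 := by norm_num
  have e0 : (1 - 2 * 0 : ℝ) ^ 2 = 1 := by norm_num
  calc _ = _ := by
        congr 1 with ζ
        rw [hphi]
        simp [derivative_comp, derivative_pow, hs]
        ring
    _ = _ := h
    _ = 0 := by
        simp only [eval_comp, eval_mul, eval_sub, eval_add, eval_pow, eval_X, eval_C, eval_one,
          eval_ofNat, hv _ _ _ e1, hv _ _ _ e0, e1, e0, Nat.ofNat_pos, Nat.one_lt_ofNat,
          Nat.lt_add_one]
        ring

/-- `B_{i11} + A_{i11} = −1/3` if `i = 2` and `0` otherwise. -/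
theorem stmt_8 (i : ℕ) (hi : 1 ≤ i) :
    Bcoef i 1 1 + Acoef i 1 1 = if i = 2 then (-1 / 3 : ℝ) else 0 := by
  rw [Bcoef_add_Acoef_one_one]
  obtain rfl | rfl | ⟨n, rfl⟩ : i = 1 ∨ i = 2 ∨ ∃ n, i = n + 3 := by
    rcases i with _ | _ | _ | n
    · omega
    · simp
    · simp
    · exact Or.inr (Or.inr ⟨n, rfl⟩)
  · have h := integral_eval_derivative ((X - X ^ 2) ^ 2 : ℝ[X]) 0 1
    have e : ∫ ζ in (0 : ℝ)..1, 2 * (ζ - ζ ^ 2) * (phi 1).eval ζ = 0 := by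
      convert h using 1
      · congr 1 with ζ
        simp [phi_one, derivative_pow]
      · simp
    simp [e]
  · have h := integral_eval_derivative
      (X ^ 2 - C (14 / 3) * X ^ 3 + 6 * X ^ 4 - C (12 / 5) * X ^ 5 : ℝ[X]) 0 1
    have e : ∫ ζ in (0 : ℝ)..1, 2 * (ζ - ζ ^ 2) * (phi 2).eval ζ = -1 / 15 := by
      convert h using 1
      · congr 1 with ζ
        simp [phi, legendre_two, derivative_pow]
        ring
      · norm_num
    rw [e]
    norm_num
  · simp [integral_mul_eval_phi_add_three]
end

section
/- Let g > 0, h₀ > 0, h > 0 be real numbers, u_{m,0} a nonzero real number, and u_m, α₁, α_{1,0} real numbers. Assume the steady-state invariants of the PHSWME system: h·u_m = h₀·u_{m,0}, α₁·h₀ = α_{1,0}·h, and (1/2)g·h² + h·u_m² + (1/3)h·α₁² = (1/2)g·h₀² + h₀·u_{m,0}² + (1/3)h₀·α_{1,0}². Set Fr := u_{m,0}/√(g·h₀), Ma₁ := α_{1,0}/u_{m,0}, and x := h/h₀. Then either h = h₀, or −Fr² + (1/2)(x² + x) + (Fr²·Ma₁²/3)·(x³ + x² + x) = 0. -/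
/-- Steady states of the PHSWME system: given the steady-state invariants (constant discharge,
constant ratio `α₁/h`, and constant momentum flux), either `h = h₀` or the water height ratio
`x = h/h₀` satisfies
`−Fr² + (1/2)(x² + x) + (Fr²·Ma₁²/3)(x³ + x² + x) = 0`,
where `Fr = u_{m,0}/√(gh₀)` and `Ma₁ = α_{1,0}/u_{m,0}`. -/
theorem stmt_14 (g h₀ h um₀ um α₁ α₁₀ : ℝ) (hg : 0 < g) (hh₀ : 0 < h₀) (hh : 0 < h)
    (hum₀ : um₀ ≠ 0)
    (inv1 : h * um = h₀ * um₀)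
    (inv2 : α₁ * h₀ = α₁₀ * h)
    (inv3 : 1 / 2 * g * h ^ 2 + h * um ^ 2 + 1 / 3 * h * α₁ ^ 2
      = 1 / 2 * g * h₀ ^ 2 + h₀ * um₀ ^ 2 + 1 / 3 * h₀ * α₁₀ ^ 2) :
    h = h₀ ∨
      -(um₀ / Real.sqrt (g * h₀)) ^ 2
        + 1 / 2 * ((h / h₀) ^ 2 + h / h₀)
        + (um₀ / Real.sqrt (g * h₀)) ^ 2 * (α₁₀ / um₀) ^ 2 / 3
            * ((h / h₀) ^ 3 + (h / h₀) ^ 2 + h / h₀) = 0 := by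
  obtain ⟨x, rfl⟩ : ∃ x, h = x * h₀ := ⟨h / h₀, by field_simp⟩
  have hα : α₁ = α₁₀ * x := mul_right_cancel₀ hh₀.ne' (by linear_combination inv2)
  have hu : um₀ = x * um := mul_left_cancel₀ hh₀.ne' (by linear_combination -inv1)
  have factored : (x - 1) * (-um₀ ^ 2 + g * h₀ / 2 * (x ^ 2 + x)
      + α₁₀ ^ 2 / 3 * (x ^ 3 + x ^ 2 + x)) = 0 := by
    refine (mul_eq_zero.mp ?_).resolve_left hh₀.ne'
    subst hα hu
    linear_combination x * inv3
  rcases mul_eq_zero.mp factored with hx | hx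
  · left
    rw [sub_eq_zero.mp hx, one_mul]
  · right
    rw [mul_div_cancel_right₀ x hh₀.ne', div_pow, Real.sq_sqrt (by positivity)]
    clear hu
    field_simp
    linear_combination 6 * hx
end

section
/- Let N ≥ 2 be an integer, g, u_m, α₂, …, α_N real numbers, h a nonzero real number, and α₁ a nonzero real number. Then for every λ ∈ ℝ, det(A^{PMHSWME}_p − λ·I_{N+2}) = ((−α₁)^N · N! / (2N+1)!!) · P'_{N+1}((λ − u_m)/α₁) · ((λ − u_m)² − gh − α₁² − Σ_{i=2}^N α_i²/(2i+1)). -/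
open Polynomial

/-- The PMHSWME system matrix in primitive variables. -/
noncomputable def APMHSWMEp (N : ℕ) (g h um : ℝ) (α : ℕ → ℝ) :
    Matrix (Fin (N + 2)) (Fin (N + 2)) ℝ := fun r c =>
  if r.val = 0 then (if c.val = 0 then um else if c.val = 1 then h else 0)
  else if r.val = 1 then
    (if c.val = 0 then g + (1 / h) * ∑ j ∈ Finset.Icc 1 N, (α j) ^ 2 / (2 * (j : ℝ) + 1)
     else if c.val = 1 then um
     else 2 / (2 * (c.val : ℝ) - 1) * α (c.val - 1))
  else if c.val = 0 then (if r.val = 3 then -((α 1) ^ 2) / (3 * h) else 0)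
  else if c.val = 1 then (if r.val = 2 then α 1 else 0)
  else (if r = c then um else 0) + A2entry (α 1) (r.val - 2) (c.val - 2)

/-- Contiguity relation for the derivatives `D^(n+1) (X² - 1)^n`. -/
theorem iterate_derivative_sq_sub_one_pow_rec (n : ℕ) :
    ((n : ℝ[X]) + 1) * derivative^[n + 3] ((X ^ 2 - 1 : ℝ[X]) ^ (n + 2)) =
      2 * ((n : ℝ[X]) + 2) * (2 * (n : ℝ[X]) + 3) *
          (X * derivative^[n + 2] ((X ^ 2 - 1 : ℝ[X]) ^ (n + 1))) -
        4 * ((n : ℝ[X]) + 1) * ((n : ℝ[X]) + 2) ^ 2 *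
          derivative^[n + 1] ((X ^ 2 - 1 : ℝ[X]) ^ n) := by
  have deriv_pow (k : ℕ) : derivative ((X ^ 2 - 1 : ℝ[X]) ^ (k + 1)) =
      ((2 * (k + 1) : ℕ) : ℝ[X]) * (X * (X ^ 2 - 1) ^ k) := by
    rw [derivative_pow_succ]
    simp
    ring
  have h1 : derivative^[n + 3] ((X ^ 2 - 1 : ℝ[X]) ^ (n + 2)) =
      2 * ((n : ℝ[X]) + 2) * (X * derivative^[n + 2] ((X ^ 2 - 1 : ℝ[X]) ^ (n + 1)) +
        ((n : ℝ[X]) + 2) * derivative^[n + 1] ((X ^ 2 - 1 : ℝ[X]) ^ (n + 1))) := by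
    rw [Function.iterate_succ_apply, deriv_pow, iterate_derivative_natCast_mul,
      mul_comm X, iterate_derivative_mul_X, nsmul_eq_mul]
    push_cast
    ring
  have h2 : derivative^[n + 3] ((X ^ 2 - 1 : ℝ[X]) ^ (n + 2)) =
      2 * ((n : ℝ[X]) + 2) *
        ((2 * (n : ℝ[X]) + 3) * derivative^[n + 1] ((X ^ 2 - 1 : ℝ[X]) ^ (n + 1)) +
        2 * ((n : ℝ[X]) + 1) * derivative^[n + 1] ((X ^ 2 - 1 : ℝ[X]) ^ n)) := by
    have h3 : derivative (X * (X ^ 2 - 1 : ℝ[X]) ^ (n + 1)) =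
        ((2 * n + 3 : ℕ) : ℝ[X]) * (X ^ 2 - 1) ^ (n + 1) +
          ((2 * (n + 1) : ℕ) : ℝ[X]) * (X ^ 2 - 1) ^ n := by
      rw [derivative_mul, deriv_pow]
      simp
      ring
    rw [Function.iterate_succ_apply, deriv_pow, iterate_derivative_natCast_mul,
      Function.iterate_succ_apply, h3, iterate_map_add, iterate_derivative_natCast_mul,
      iterate_derivative_natCast_mul]
    push_cast
    ring
  linear_combination (2 * (n : ℝ[X]) + 3) * h1 - ((n : ℝ[X]) + 2) * h2

/-- Three-term recurrence for the derivatives of the Legendre polynomials. -/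
theorem eval_derivative_legendre_rec (n : ℕ) (x : ℝ) :
    ((n : ℝ) + 1) * (derivative (legendre (n + 2))).eval x =
      (2 * n + 3) * x * (derivative (legendre (n + 1))).eval x -
        (n + 2) * (derivative (legendre n)).eval x := by
  have h := congrArg (eval x) (iterate_derivative_sq_sub_one_pow_rec n)
  simp only [eval_mul, eval_sub, eval_add, eval_X, eval_natCast, eval_one, eval_pow,
    eval_ofNat] at h
  have hf : (n.factorial : ℝ) ≠ 0 := by positivity
  simp only [legendre, derivative_smul, ← Function.iterate_succ_apply', eval_smul, smul_eq_mul,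
    Nat.factorial_succ, Nat.succ_eq_add_one]
  push_cast
  field_simp
  linear_combination 2 * 2 ^ (n * 2) * h

/-- Continuant recurrence for the leading principal minors of a tridiagonal array. -/
theorem det_tridiagonal_rec {R : Type*} [CommRing R] (T : ℕ → ℕ → R)
    (hT : ∀ i j, i + 1 < j ∨ j + 1 < i → T i j = 0) (n : ℕ) :
    (Matrix.of fun i j : Fin (n + 2) => T i j).det =
      T (n + 1) (n + 1) * (Matrix.of fun i j : Fin (n + 1) => T i j).det -
        T (n + 1) n * T n (n + 1) * (Matrix.of fun i j : Fin n => T i j).det := by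
  have hsub : ((Matrix.of fun i j : Fin (n + 2) => T i j).submatrix
      (Fin.last (n + 1)).succAbove (Fin.castSucc (Fin.last n)).succAbove).det =
      T n (n + 1) * (Matrix.of fun i j : Fin n => T i j).det := by
    rw [Matrix.det_succ_column _ (Fin.last n), Fin.sum_univ_castSucc, Finset.sum_eq_zero]
    · have hm : (((Matrix.of fun i j : Fin (n + 2) => T i j).submatrix
          (Fin.last (n + 1)).succAbove (Fin.castSucc (Fin.last n)).succAbove).submatrix
          (Fin.last n).succAbove (Fin.last n).succAbove) =
          Matrix.of fun i j : Fin n => T i j := by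
        ext i j
        simp [Fin.succAbove, Fin.lt_def]
      rw [hm]
      simp [Fin.succAbove, ← two_mul]
    · intro i _
      simp [Fin.succAbove, hT i (n + 1) (by left; omega)]
  have hlast : ((Matrix.of fun i j : Fin (n + 2) => T i j).submatrix
      (Fin.last (n + 1)).succAbove (Fin.last (n + 1)).succAbove) =
      Matrix.of fun i j : Fin (n + 1) => T i j := by
    ext i j
    simp
  rw [Matrix.det_succ_row _ (Fin.last (n + 1)), Fin.sum_univ_castSucc, Fin.sum_univ_castSucc,
    Finset.sum_eq_zero, hsub, hlast]
  · have h1 : (-1 : R) ^ (n + 1 + n) = -1 := Odd.neg_one_pow ⟨n, by ring⟩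
    have h2 : (-1 : R) ^ (n + 1 + (n + 1)) = 1 := Even.neg_one_pow ⟨n + 1, rfl⟩
    simp [h1, h2]
    ring
  · intro i _
    simp [hT (n + 1) i (by right; omega)]

/-- Entry of the shifted tridiagonal matrix `A₂ - μ I`. -/
noncomputable def shiftedA2entry (a μ : ℝ) (i j : ℕ) : ℝ :=
  (if i = j then -μ else 0) + A2entry a i j

/-- The characteristic polynomial of `A₂` is a rescaled Legendre derivative. -/
theorem det_shiftedA2 (a μ : ℝ) (ha : a ≠ 0) (N : ℕ) :
    (Matrix.of fun i j : Fin N => shiftedA2entry a μ i j).det =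
      (-a) ^ N * (N.factorial : ℝ) / (Nat.doubleFactorial (2 * N + 1) : ℝ) *
        (derivative (legendre (N + 1))).eval (μ / a) := by
  induction N using Nat.twoStepInduction with
  | zero =>
    norm_num [legendre]
  | one =>
    have h := eval_derivative_legendre_rec 0 (μ / a)
    simp [legendre] at h
    simp [shiftedA2entry, A2entry, Nat.doubleFactorial, legendre, h]
    field_simp
    norm_num
  | more n ih0 ih1 =>
    rw [det_tridiagonal_rec, ih0, ih1]
    · have h := eval_derivative_legendre_rec (n + 1) (μ / a)
      have hd1 : Nat.doubleFactorial (2 * (n + 1) + 1) =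
          (2 * n + 3) * Nat.doubleFactorial (2 * n + 1) := Nat.doubleFactorial_add_two _
      have hd2 : Nat.doubleFactorial (2 * (n + 2) + 1) =
          (2 * n + 5) * ((2 * n + 3) * Nat.doubleFactorial (2 * n + 1)) := by
        rw [← hd1]
        exact Nat.doubleFactorial_add_two _
      have hd : (Nat.doubleFactorial (2 * n + 1) : ℝ) ≠ 0 := by
        exact_mod_cast (Nat.doubleFactorial_pos _).ne'
      have hP : (derivative (legendre (n + 2 + 1))).eval (μ / a) =
          ((2 * n + 5) * (μ / a) * (derivative (legendre (n + 1 + 1))).eval (μ / a) -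
            (n + 3) * (derivative (legendre (n + 1))).eval (μ / a)) / (n + 2) := by
        rw [eq_div_iff (by positivity)]
        push_cast at h
        linear_combination h
      rw [hP, hd1, hd2]
      have hdiag : shiftedA2entry a μ (n + 1) (n + 1) = -μ := by simp [shiftedA2entry, A2entry]
      have hsup : shiftedA2entry a μ n (n + 1) = (n + 3) / (2 * n + 5) * a := by
        simp [shiftedA2entry, A2entry]
      have hsub : shiftedA2entry a μ (n + 1) n = (n + 1) / (2 * n + 3) * a := by
        simp [shiftedA2entry, A2entry, show n ≠ n + 1 + 1 by omega]
      rw [hdiag, hsup, hsub]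
      simp only [Nat.factorial_succ]
      push_cast
      field_simp
      ring
    · intro i j hij
      simp only [shiftedA2entry, A2entry]
      rw [if_neg (by omega), if_neg (by omega), if_neg (by omega), add_zero]

/-- Characteristic polynomial of the primitive PMHSWME system matrix. -/
theorem stmt_15 (N : ℕ) (hN : 2 ≤ N) (g um : ℝ) (h : ℝ) (hh : h ≠ 0)
    (α : ℕ → ℝ) (hα1 : α 1 ≠ 0) (lam : ℝ) :
    (APMHSWMEp N g h um α - lam • (1 : Matrix (Fin (N + 2)) (Fin (N + 2)) ℝ)).det =
      (-(α 1)) ^ N * (N.factorial : ℝ) / (Nat.doubleFactorial (2 * N + 1) : ℝ) *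
        (derivative (legendre (N + 1))).eval ((lam - um) / α 1) *
        ((lam - um) ^ 2 - g * h - (α 1) ^ 2 -
          ∑ i ∈ Finset.Icc 2 N, (α i) ^ 2 / (2 * (i : ℝ) + 1)) := by
  set M := APMHSWMEp N g h um α - lam • (1 : Matrix (Fin (N + 2)) (Fin (N + 2)) ℝ) with hM
  obtain ⟨n, rfl⟩ : ∃ n, N = n + 2 := ⟨N - 2, by omega⟩
  set Q := (lam - um) ^ 2 - g * h - (α 1) ^ 2 -
    ∑ i ∈ Finset.Icc 2 (n + 2), (α i) ^ 2 / (2 * (i : ℝ) + 1) with hQ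
  have hsum : ∑ j ∈ Finset.Icc 1 (n + 2), (α j) ^ 2 / (2 * (j : ℝ) + 1) =
      (α 1) ^ 2 / 3 + ∑ i ∈ Finset.Icc 2 (n + 2), (α i) ^ 2 / (2 * (i : ℝ) + 1) := by
    rw [← Finset.add_sum_Ioc_eq_sum_Icc (by omega)]
    norm_num
    rfl
  let v : Fin (n + 2 + 2) → ℝ := Fin.cons h (Fin.cons (lam - um) (Fin.cons (α 1) 0))
  have hv : M.mulVec v = Pi.single 1 (-Q) := by
    funext r
    have hr : M.mulVec v r = M r ⟨0, by omega⟩ * h + M r ⟨1, by omega⟩ * (lam - um) +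
        M r ⟨2, by omega⟩ * α 1 := by
      simp only [Matrix.mulVec, dotProduct]
      rw [Fin.sum_univ_succ, Fin.sum_univ_succ, Fin.sum_univ_succ]
      simp [v]
      ring_nf
      rfl
    have hs : (Pi.single 1 (-Q) : Fin (n + 2 + 2) → ℝ) r = if (r : ℕ) = 1 then -Q else 0 := by
      simp [Pi.single_apply, Fin.ext_iff]
    rw [hr, hs]
    simp only [hM, APMHSWMEp, A2entry, Matrix.sub_apply, Matrix.smul_apply, Matrix.one_apply,
      Fin.ext_iff]
    generalize (r : ℕ) = k
    rcases k with _ | _ | _ | _ | k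
    · simp
      ring
    · simp [hQ, hsum]
      field_simp
      ring
    · simp
      ring
    · simp
      field_simp
      ring
    · simp
  have hadj : M.adjugate 0 1 * (-Q) = M.det * h := by
    have h1 := congrFun (congrArg M.adjugate.mulVec hv) 0
    rw [Matrix.mulVec_mulVec, Matrix.adjugate_mul, Matrix.smul_mulVec, Matrix.one_mulVec] at h1
    simpa [v, mul_comm] using h1.symm
  have hminor : M.adjugate 0 1 =
      -(h * (Matrix.of fun i j : Fin (n + 2) => shiftedA2entry (α 1) (lam - um) i j).det) := by
    rw [Matrix.adjugate_fin_succ_eq_det_submatrix, Matrix.det_succ_row_zero, Fin.sum_univ_succ,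
      Finset.sum_eq_zero]
    · have hm : ((M.submatrix (Fin.succAbove 1) (Fin.succAbove 0)).submatrix Fin.succ
          (Fin.succAbove 0)) =
          Matrix.of fun i j : Fin (n + 2) => shiftedA2entry (α 1) (lam - um) i j := by
        ext i j
        by_cases hij : i = j
        · subst hij
          simp [hM, APMHSWMEp, shiftedA2entry]
          ring
        · have hij' : i.val ≠ j.val := fun e => hij (Fin.ext e)
          simp [hM, APMHSWMEp, shiftedA2entry, hij, hij']
      rw [hm]
      simp [hM, APMHSWMEp]
    · intro i _
      have h0 : (0 : Fin (n + 2 + 2)) ≠ i.succ.succ := (Fin.succ_ne_zero _).symm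
      simp [hM, APMHSWMEp, h0]
  rw [hminor] at hadj
  rw [← det_shiftedA2 _ _ hα1]
  apply mul_right_cancel₀ hh
  linear_combination -hadj
end
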